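/- (Transductive analogue of the cube-root bound.) Suppose the loss ℓ is l-Lipschitz in its first argument and bounded by b. Fix a target matrix Y and a multiset S̄ of 2s index pairs in [n]×[m], and let p̄ denote the unsmoothed empirical marginals of S̄: p̄^r(i) = #{t : i_t = i}/(2s), p̄^c(j) = #{t : j_t = j}/(2s), with no further assumptions on p̄. Split S̄ uniformly at random into a training set S and a test set T of size s each, and let X̂_S = argmin{L̂_S(X) : X ∈ W_p̄}. Then there is an absolute constant C such that, in expectation over the split, E[L̂_T(X̂_S)] ≤ inf_{X ∈ W_p̄} L̂_T(X) + C·(l+b)·(r·n·log(n)/s)^{1/3}. -/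

import Mathlib

open scoped Classical
open Matrix Finset

noncomputable section

/-- Trace norm (sum of singular values) of a real matrix. -/
def traceNorm {n m : ℕ} (X : Matrix (Fin n) (Fin m) ℝ) : ℝ :=
  ∑ j, Real.sqrt ((Matrix.isHermitian_conjTranspose_mul_self X).eigenvalues j)

/-- Weighted trace norm with row weights `pr` and column weights `pc`. -/
def wTrNorm {n m : ℕ} (pr : Fin n → ℝ) (pc : Fin m → ℝ)
    (X : Matrix (Fin n) (Fin m) ℝ) : ℝ :=
  traceNorm (Matrix.diagonal (fun i => Real.sqrt (pr i)) * X *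
    Matrix.diagonal (fun j => Real.sqrt (pc j)))

/-- Weighted trace-norm ball of radius `√r`. -/
def Wball {n m : ℕ} (pr : Fin n → ℝ) (pc : Fin m → ℝ) (r : ℝ) :
    Set (Matrix (Fin n) (Fin m) ℝ) :=
  {X | wTrNorm pr pc X ≤ Real.sqrt r}

/-- Row marginals of a distribution on `[n] × [m]`. -/
def rowMarg {n m : ℕ} (p : Matrix (Fin n) (Fin m) ℝ) (i : Fin n) : ℝ := ∑ j, p i j

/-- Column marginals of a distribution on `[n] × [m]`. -/
def colMarg {n m : ℕ} (p : Matrix (Fin n) (Fin m) ℝ) (j : Fin m) : ℝ := ∑ i, p i j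

/-- `p` is a probability distribution on `[n] × [m]`. -/
def IsDistrib {n m : ℕ} (p : Matrix (Fin n) (Fin m) ℝ) : Prop :=
  (∀ i j, 0 ≤ p i j) ∧ ∑ i, ∑ j, p i j = 1

/-- `ℓ` is `l`-Lipschitz in its first argument. -/
def LipLoss (l : ℝ) (ℓ : ℝ → ℝ → ℝ) : Prop :=
  ∀ x x' y, |ℓ x y - ℓ x' y| ≤ l * |x - x'|

/-- Unsmoothed empirical row marginals of a multiset `S̄` of `2s` index pairs. -/
def ubarR {n m s : ℕ} (Sbar : Fin (2 * s) → Fin n × Fin m) (i : Fin n) : ℝ :=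
  ((Finset.univ.filter fun t => (Sbar t).1 = i).card : ℝ) / (2 * (s : ℝ))

/-- Unsmoothed empirical column marginals of a multiset `S̄` of `2s` index pairs. -/
def ubarC {n m s : ℕ} (Sbar : Fin (2 * s) → Fin n × Fin m) (j : Fin m) : ℝ :=
  ((Finset.univ.filter fun t => (Sbar t).2 = j).card : ℝ) / (2 * (s : ℝ))

/-- Smoothed empirical row marginals of `S̄`: `p̄^r(i) = (#{t : i_t = i}/(2s) + 1/n)/2`. -/
def barR {n m s : ℕ} (Sbar : Fin (2 * s) → Fin n × Fin m) (i : Fin n) : ℝ :=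
  (ubarR Sbar i + 1 / (n : ℝ)) / 2

/-- Smoothed empirical column marginals of `S̄`. -/
def barC {n m s : ℕ} (Sbar : Fin (2 * s) → Fin n × Fin m) (j : Fin m) : ℝ :=
  (ubarC Sbar j + 1 / (m : ℝ)) / 2

/-- Empirical risk over the set `U` of positions of `S̄`. -/
def empRiskOn {n m s : ℕ} (ℓ : ℝ → ℝ → ℝ) (Y : Matrix (Fin n) (Fin m) ℝ)
    (Sbar : Fin (2 * s) → Fin n × Fin m) (U : Finset (Fin (2 * s)))
    (X : Matrix (Fin n) (Fin m) ℝ) : ℝ :=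
  (1 / (U.card : ℝ)) * ∑ t ∈ U, ℓ (X (Sbar t).1 (Sbar t).2) (Y (Sbar t).1 (Sbar t).2)

/-- Expectation over a uniformly random subset `B ⊆ [2s]` of size `s`
(the training half of the split; the test half is `Bᶜ`). -/
def Esplit (s : ℕ) (f : Finset (Fin (2 * s)) → ℝ) : ℝ :=
  (∑ B ∈ Finset.univ.filter (fun B : Finset (Fin (2 * s)) => B.card = s), f B) /
    (Nat.choose (2 * s) s : ℝ)

/-- Empirical Rademacher complexity of a class of matrices on the positions `B` of `S̄`,
with one Rademacher sign per element of `B`. -/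
def radOnSub {n m N : ℕ} (Sbar : Fin N → Fin n × Fin m) (B : Finset (Fin N))
    (𝒳 : Set (Matrix (Fin n) (Fin m) ℝ)) : ℝ :=
  (1 / (2 ^ B.card : ℝ)) * ∑ σ : {t // t ∈ B} → Bool,
    sSup ((fun X => (1 / (B.card : ℝ)) *
      ∑ t : {t // t ∈ B}, (if σ t then (1 : ℝ) else -1) *
        X (Sbar t.1).1 (Sbar t.1).2) '' 𝒳)

theorem aux_spec {ι : Type*} [Fintype ι] [DecidableEq ι] (W : Matrix ι ι ℝ) (hW : Wᵀ = W) :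
    ∃ (U : Matrix ι ι ℝ) (w : ι → ℝ), Uᵀ * U = 1 ∧ U * Uᵀ = 1 ∧
      ∀ a : ℕ, W ^ a = U * diagonal (fun i => w i ^ a) * Uᵀ := by
  have hA : W.IsHermitian := by
    rw [Matrix.IsHermitian, Matrix.conjTranspose_eq_transpose_of_trivial, hW]
  have h1 : (hA.eigenvectorUnitary : Matrix ι ι ℝ)ᵀ * (hA.eigenvectorUnitary : Matrix ι ι ℝ) = 1 := by
    have := Unitary.coe_star_mul_self hA.eigenvectorUnitary
    rwa [Matrix.star_eq_conjTranspose, Matrix.conjTranspose_eq_transpose_of_trivial] at this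
  have h2 := mul_eq_one_comm.mp h1
  refine ⟨hA.eigenvectorUnitary, hA.eigenvalues, h1, h2, ?_⟩
  intro a
  have h3 : W = (hA.eigenvectorUnitary : Matrix ι ι ℝ) * diagonal hA.eigenvalues *
      (hA.eigenvectorUnitary : Matrix ι ι ℝ)ᵀ := by
    have := hA.spectral_theorem
    rw [Unitary.conjStarAlgAut_apply, Matrix.star_eq_conjTranspose,
      Matrix.conjTranspose_eq_transpose_of_trivial] at this
    exact this
  induction a with
  | zero => simp [h2]
  | succ k ih =>
    rw [pow_succ, ih]
    refine (congrArg (_ * ·) h3).trans ?_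
    show _ * (_ * _ * _) = _
    calc _ = (hA.eigenvectorUnitary : Matrix ι ι ℝ) * diagonal (fun i => hA.eigenvalues i ^ k) *
          ((hA.eigenvectorUnitary : Matrix ι ι ℝ)ᵀ * (hA.eigenvectorUnitary : Matrix ι ι ℝ)) *
          diagonal hA.eigenvalues * (hA.eigenvectorUnitary : Matrix ι ι ℝ)ᵀ := by
          simp only [Matrix.mul_assoc]
      _ = _ := by
          rw [h1, Matrix.mul_one, Matrix.mul_assoc _ (diagonal _) (diagonal _), diagonal_mul_diagonal]
          simp only [pow_succ]

theorem aux_trace {ι : Type*} [Fintype ι] [DecidableEq ι] (W Y : Matrix ι ι ℝ) (hW : Wᵀ = W) (hY : Yᵀ = Y) :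
    ∃ (w y : ι → ℝ) (C : Matrix ι ι ℝ), ∀ a b : ℕ,
      trace (W ^ a * Y ^ b) = ∑ i, ∑ j, w i ^ a * y j ^ b * C i j ^ 2 := by
  obtain ⟨U, w, hU1, hU2, hw⟩ := aux_spec W hW
  obtain ⟨V, y, hV1, hV2, hy⟩ := aux_spec Y hY
  refine ⟨w, y, Uᵀ * V, fun a b => ?_⟩
  rw [hw, hy]
  have : U * diagonal (fun i => w i ^ a) * Uᵀ * (V * diagonal (fun i => y i ^ b) * Vᵀ)
      = U * (diagonal (fun i => w i ^ a) * (Uᵀ * V) * diagonal (fun i => y i ^ b) * Vᵀ) := by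
    simp only [Matrix.mul_assoc]
  rw [this, trace_mul_comm]
  have : diagonal (fun i => w i ^ a) * (Uᵀ * V) * diagonal (fun i => y i ^ b) * Vᵀ * U
    = (diagonal (fun i => w i ^ a) * (Uᵀ * V) * diagonal (fun i => y i ^ b)) * (Uᵀ * V)ᵀ := by
    rw [transpose_mul, transpose_transpose]; simp only [Matrix.mul_assoc]
  rw [this]
  simp only [trace, diag_apply]
  refine Finset.sum_congr rfl fun i _ => ?_
  rw [Matrix.mul_apply]
  refine Finset.sum_congr rfl fun j _ => ?_
  rw [mul_diagonal, diagonal_mul, transpose_apply]; ring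

theorem aux_scalar1 (x y : ℝ) (r q : ℕ) (hq : q ≤ 2 * r) :
    x ^ q * y ^ (2 * r - q) + x ^ (2 * r - q) * y ^ q ≤ x ^ (2 * r) + y ^ (2 * r) := by
  have h : x ^ q * y ^ (2 * r - q) + x ^ (2 * r - q) * y ^ q ≤
      |x| ^ q * |y| ^ (2 * r - q) + |x| ^ (2 * r - q) * |y| ^ q := by
    simp only [← abs_pow, ← abs_mul]
    exact add_le_add (le_abs_self _) (le_abs_self _)
  refine h.trans ?_
  have h2 : ∀ z : ℝ, z ^ (2 * r) = |z| ^ q * |z| ^ (2 * r - q) := by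
    intro z
    rw [← pow_add, Nat.add_sub_cancel' hq, pow_mul, pow_mul, sq_abs]
  rw [h2 x, h2 y]
  have hx := abs_nonneg x
  have hy := abs_nonneg y
  have : 0 ≤ (|x| ^ q - |y| ^ q) * (|x| ^ (2 * r - q) - |y| ^ (2 * r - q)) := by
    rcases le_total |x| |y| with h | h
    · exact mul_nonneg_of_nonpos_of_nonpos (sub_nonpos.2 (pow_le_pow_left₀ hx h _))
        (sub_nonpos.2 (pow_le_pow_left₀ hx h _))
    · exact mul_nonneg (sub_nonneg.2 (pow_le_pow_left₀ hy h _))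
        (sub_nonneg.2 (pow_le_pow_left₀ hy h _))
  nlinarith

theorem aux_scalar2 (x y : ℝ) (r : ℕ) :
    2 * ((x - y) * (x ^ (2 * r + 1) - y ^ (2 * r + 1))) ≤
      (2 * r + 1) * ((x - y) ^ 2 * (x ^ (2 * r) + y ^ (2 * r))) := by
  have h1 := Commute.mul_geom_sum₂ (Commute.all x y) (2 * r + 1)
  have h2 : 2 * ∑ i ∈ range (2 * r + 1), x ^ i * y ^ (2 * r + 1 - 1 - i) ≤
      (2 * r + 1) * (x ^ (2 * r) + y ^ (2 * r)) := by
    rw [two_mul]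
    nth_rewrite 2 [← Finset.sum_range_reflect]
    rw [← Finset.sum_add_distrib]
    calc _ ≤ ∑ i ∈ range (2 * r + 1), (x ^ (2 * r) + y ^ (2 * r)) := by
          refine Finset.sum_le_sum fun i hi => ?_
          have hi' : i ≤ 2 * r := by simpa [Nat.lt_succ_iff] using hi
          have := aux_scalar1 x y r i hi'
          have e : 2 * r - (2 * r - i) = i := by omega
          simpa [e] using this
      _ = _ := by simp [mul_add]
  rw [← h1]
  nlinarith [mul_le_mul_of_nonneg_left h2 (sq_nonneg (x - y))]

theorem aux_key {ι : Type*} [Fintype ι] [DecidableEq ι] (W Y H : Matrix ι ι ℝ) (hW : Wᵀ = W) (hY : Yᵀ = Y)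
    (hH : W - Y = (2 : ℝ) • H) (r : ℕ) :
    trace (H * (W ^ (2 * r + 1) - Y ^ (2 * r + 1))) ≤
      (2 * r + 1) * (trace (H * H * W ^ (2 * r)) + trace (H * H * Y ^ (2 * r))) := by
  obtain ⟨w, y, C, h⟩ := aux_trace W Y hW hY
  have hH' : H = (1 / 2 : ℝ) • (W - Y) := by rw [hH, smul_smul]; norm_num
  have e1 : trace (H * (W ^ (2 * r + 1) - Y ^ (2 * r + 1))) = 1 / 2 *
      ∑ i, ∑ j, (w i - y j) * (w i ^ (2 * r + 1) - y j ^ (2 * r + 1)) * C i j ^ 2 := by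
    have : H * (W ^ (2 * r + 1) - Y ^ (2 * r + 1)) = (1 / 2 : ℝ) •
      (W ^ (2 * r + 2) * Y ^ 0 - W ^ 1 * Y ^ (2 * r + 1) - Y * W ^ (2 * r + 1) +
        W ^ 0 * Y ^ (2 * r + 2)) := by
      rw [hH', Matrix.smul_mul]; congr 1
      rw [pow_succ' _ (2 * r + 1), pow_succ' _ (2 * r + 1)]
      noncomm_ring
    rw [this, trace_smul, trace_add, trace_sub, trace_sub, trace_mul_comm Y, ← pow_one Y,
      pow_one Y, ← pow_one Y]
    simp only [← pow_mul, one_mul]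
    rw [h, h, h, h, smul_eq_mul]
    simp only [← Finset.sum_sub_distrib, ← Finset.sum_add_distrib]
    congr 1
    refine Finset.sum_congr rfl fun i _ => Finset.sum_congr rfl fun j _ => ?_
    ring
  have e2 : trace (H * H * W ^ (2 * r)) = 1 / 4 *
      ∑ i, ∑ j, (w i - y j) ^ 2 * w i ^ (2 * r) * C i j ^ 2 := by
    have : H * H * W ^ (2 * r) = (1 / 4 : ℝ) •
      (W ^ (2 * r + 2) * Y ^ 0 - W * Y * W ^ (2 * r) - Y * W ^ (2 * r + 1) +
        Y ^ 2 * W ^ (2 * r)) := by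
      rw [hH', Matrix.smul_mul, Matrix.mul_smul, smul_smul, Matrix.smul_mul,
        show (1 / 2 * (1 / 2) : ℝ) = 1 / 4 by norm_num]
      congr 1
      rw [pow_succ' _ (2 * r + 1), pow_succ' _ (2 * r)]
      noncomm_ring
    rw [this, trace_smul, trace_add, trace_sub, trace_sub, trace_mul_comm Y,
      trace_mul_comm (W * Y), ← Matrix.mul_assoc, ← pow_succ, trace_mul_comm (Y ^ 2)]
    have hh := h (2 * r + 1) 1
    rw [pow_one] at hh
    rw [h, h, hh, smul_eq_mul]
    simp only [← Finset.sum_sub_distrib, ← Finset.sum_add_distrib]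
    congr 1
    refine Finset.sum_congr rfl fun i _ => Finset.sum_congr rfl fun j _ => ?_
    ring
  have e3 : trace (H * H * Y ^ (2 * r)) = 1 / 4 *
      ∑ i, ∑ j, (w i - y j) ^ 2 * y j ^ (2 * r) * C i j ^ 2 := by
    have : H * H * Y ^ (2 * r) = (1 / 4 : ℝ) •
      (W ^ 0 * Y ^ (2 * r + 2) - W * Y ^ (2 * r + 1) - Y * W * Y ^ (2 * r) +
        W ^ 2 * Y ^ (2 * r)) := by
      rw [hH', Matrix.smul_mul, Matrix.mul_smul, smul_smul, Matrix.smul_mul,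
        show (1 / 2 * (1 / 2) : ℝ) = 1 / 4 by norm_num]
      congr 1
      rw [pow_succ' _ (2 * r + 1), pow_succ' _ (2 * r)]
      noncomm_ring
    rw [this, trace_smul, trace_add, trace_sub, trace_sub, 
      Matrix.mul_assoc Y, trace_mul_comm Y, Matrix.mul_assoc W, ← pow_succ]
    have hh := h 1 (2 * r + 1)
    rw [pow_one] at hh
    rw [h, h, hh, smul_eq_mul]
    simp only [← Finset.sum_sub_distrib, ← Finset.sum_add_distrib]
    congr 1
    refine Finset.sum_congr rfl fun i _ => Finset.sum_congr rfl fun j _ => ?_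
    ring
  rw [e1, e2, e3, ← mul_add, ← Finset.sum_add_distrib]
  simp only [← Finset.sum_add_distrib]
  have : ∑ i, ∑ j, (w i - y j) * (w i ^ (2 * r + 1) - y j ^ (2 * r + 1)) * C i j ^ 2 ≤
     ∑ i, ∑ j, ((2 * r + 1) / 2 : ℝ) * ((w i - y j) ^ 2 * w i ^ (2 * r) * C i j ^ 2 + 
        (w i - y j) ^ 2 * y j ^ (2 * r) * C i j ^ 2) := by
    refine Finset.sum_le_sum fun i _ => Finset.sum_le_sum fun j _ => ?_
    nlinarith [mul_le_mul_of_nonneg_right (aux_scalar2 (w i) (y j) r) (sq_nonneg (C i j))]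
  simp only [← Finset.mul_sum] at this
  linarith

theorem aux_quad {ι : Type*} [Fintype ι] [DecidableEq ι] (W : Matrix ι ι ℝ) (hW : Wᵀ = W) (p : ℕ) (hp : 1 ≤ p)
    (L : ℝ) (hL : 0 ≤ L) (hLp : trace (W ^ (2 * p)) ≤ L ^ (2 * p)) (z : ι → ℝ) :
    z ⬝ᵥ (W *ᵥ z) ≤ L * (z ⬝ᵥ z) := by
  obtain ⟨U, w, hU1, hU2, hw⟩ := aux_spec W hW
  have hwL : ∀ i, w i ≤ L := by
    intro i
    have h1 : trace (W ^ (2 * p)) = ∑ i, w i ^ (2 * p) := by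
      rw [hw, trace_mul_comm, ← Matrix.mul_assoc, hU1, Matrix.one_mul, trace_diagonal]
    have h2 : w i ^ (2 * p) ≤ L ^ (2 * p) := by
      refine le_trans ?_ hLp
      rw [h1]
      exact Finset.single_le_sum (f := fun i => w i ^ (2 * p))
        (fun i _ => by rw [pow_mul]; positivity) (mem_univ i)
    by_contra hcon
    push Not at hcon
    exact absurd h2 (not_le.2 (pow_lt_pow_left₀ hcon hL (by omega)))
  set c := Uᵀ *ᵥ z with hc
  have hz : z = U *ᵥ c := by rw [hc, mulVec_mulVec, hU2, one_mulVec]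
  have hcU : z ᵥ* U = c := by rw [hc, mulVec_transpose]
  have e1 : z ⬝ᵥ (W *ᵥ z) = ∑ i, w i * c i ^ 2 := by
    have := hw 1
    rw [pow_one] at this
    rw [this, ← mulVec_mulVec, ← mulVec_mulVec, ← hc, dotProduct_mulVec, hcU]
    simp only [dotProduct, mulVec_diagonal]
    refine Finset.sum_congr rfl fun i _ => ?_
    ring
  have e2 : z ⬝ᵥ z = ∑ i, c i ^ 2 := by
    conv_lhs => rw [hz, dotProduct_mulVec, ← hz, hcU]
    simp only [dotProduct, sq]
  rw [e1, e2, Finset.mul_sum]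
  exact Finset.sum_le_sum fun i _ => mul_le_mul_of_nonneg_right (hwL i) (sq_nonneg _)

def sg (b : Bool) : ℝ := if b then 1 else -1

theorem sg_not (b : Bool) : sg (!b) = - sg b := by cases b <;> simp [sg]
theorem sg_sq (b : Bool) : sg b * sg b = 1 := by cases b <;> simp [sg]

def flipAt {κ : Type*} [DecidableEq κ] (k : κ) (σ : κ → Bool) : κ → Bool := Function.update σ k (!σ k)

theorem flipAt_invol {κ : Type*} [DecidableEq κ] (k : κ) : Function.Involutive (flipAt k) := by
  intro σ; simp [flipAt]

theorem sum_flipAt {κ : Type*} [Fintype κ] [DecidableEq κ] (k : κ) (f : (κ → Bool) → ℝ) :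
    ∑ σ, f (flipAt k σ) = ∑ σ, f σ :=
  Equiv.sum_comp (flipAt_invol k).toPerm f

def ranX {ι κ : Type*} [Fintype κ] (H : κ → Matrix ι ι ℝ) (σ : κ → Bool) : Matrix ι ι ℝ :=
  ∑ k, sg (σ k) • H k

theorem ranX_sym {ι κ : Type*} [Fintype κ] (H : κ → Matrix ι ι ℝ)
    (hH : ∀ k, (H k)ᵀ = H k) (σ : κ → Bool) : (ranX H σ)ᵀ = ranX H σ := by
  simp [ranX, transpose_sum, hH]

theorem ranX_flip {ι κ : Type*} [Fintype κ] [DecidableEq κ] (H : κ → Matrix ι ι ℝ) (k : κ) (σ : κ → Bool) :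
    ranX H σ - ranX H (flipAt k σ) = (2 : ℝ) • (sg (σ k) • H k) := by
  rw [ranX, ranX, ← Finset.sum_sub_distrib, Finset.sum_eq_single k]
  · simp only [flipAt, Function.update_self, sg_not]
    rw [neg_smul, sub_neg_eq_add, two_smul]
  · intro j _ hj
    simp [flipAt, Function.update_of_ne hj]
  · simp

theorem pow_even_diag_nonneg {ι : Type*} [Fintype ι] [DecidableEq ι] (W : Matrix ι ι ℝ) (hW : Wᵀ = W) (r : ℕ)
    (i : ι) : 0 ≤ (W ^ (2 * r)) i i := by
  rw [two_mul, pow_add]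
  have h : (W ^ r)ᵀ = W ^ r := by rw [transpose_pow, hW]
  rw [Matrix.mul_apply]
  refine Finset.sum_nonneg fun j _ => ?_
  have : (W ^ r) j i = (W ^ r) i j := by
    conv_lhs => rw [← h, transpose_apply]
  rw [this]; exact mul_self_nonneg _

theorem aux_step {ι κ : Type*} [Fintype ι] [DecidableEq ι] [Fintype κ] [DecidableEq κ] (H : κ → Matrix ι ι ℝ)
    (hH : ∀ k, (H k)ᵀ = H k) (d : ι → ℝ) (hd : ∑ k, H k * H k = diagonal d) (v : ℝ)
    (hv : ∀ i, d i ≤ v) (r : ℕ) :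
    ∑ σ, trace (ranX H σ ^ (2 * (r + 1))) ≤
      (2 * r + 1) * v * ∑ σ, trace (ranX H σ ^ (2 * r)) := by
  have h1 : ∀ σ, trace (ranX H σ ^ (2 * (r + 1))) =
      ∑ k, trace ((sg (σ k) • H k) * ranX H σ ^ (2 * r + 1)) := by
    intro σ
    rw [← trace_sum, ← Finset.sum_mul, show 2 * (r + 1) = 2 * r + 1 + 1 by ring, pow_succ' _ (2 * r + 1)]
    rfl
  have h2 : ∀ k, ∑ σ, trace ((sg (σ k) • H k) * ranX H σ ^ (2 * r + 1)) ≤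
      (2 * r + 1) * ∑ σ, trace (H k * H k * ranX H σ ^ (2 * r)) := by
    intro k
    have e := sum_flipAt k (fun σ => trace ((sg (σ k) • H k) * ranX H σ ^ (2 * r + 1)))
    have e' := sum_flipAt k (fun σ => trace (H k * H k * ranX H σ ^ (2 * r)))
    have h3 : ∑ σ, trace ((sg (σ k) • H k) * ranX H σ ^ (2 * r + 1)) +
        ∑ σ, trace ((sg (flipAt k σ k) • H k) * ranX H (flipAt k σ) ^ (2 * r + 1)) ≤
        (2 * r + 1) * (∑ σ, trace (H k * H k * ranX H σ ^ (2 * r)) +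
          ∑ σ, trace (H k * H k * ranX H (flipAt k σ) ^ (2 * r))) := by
      rw [← Finset.sum_add_distrib, ← Finset.sum_add_distrib, Finset.mul_sum]
      refine Finset.sum_le_sum fun σ _ => ?_
      have := aux_key (ranX H σ) (ranX H (flipAt k σ)) (sg (σ k) • H k) (ranX_sym H hH _)
        (ranX_sym H hH _) (ranX_flip H k σ) r
      have hs : (sg (σ k) • H k) * (sg (σ k) • H k) = H k * H k := by
        rw [Matrix.smul_mul, Matrix.mul_smul, smul_smul, sg_sq, one_smul]
      rw [hs] at this
      refine le_trans (le_of_eq ?_) this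
      simp only [flipAt, Function.update_self, sg_not]
      rw [neg_smul, Matrix.neg_mul, trace_neg, Matrix.mul_sub, trace_sub]
      ring
    rw [e, e'] at h3
    linarith
  calc _ = ∑ k, ∑ σ, trace ((sg (σ k) • H k) * ranX H σ ^ (2 * r + 1)) := by
        rw [Finset.sum_comm]; exact Finset.sum_congr rfl fun σ _ => h1 σ
    _ ≤ ∑ k, (2 * r + 1) * ∑ σ, trace (H k * H k * ranX H σ ^ (2 * r)) :=
        Finset.sum_le_sum fun k _ => h2 k
    _ = (2 * r + 1) * ∑ σ, trace (diagonal d * ranX H σ ^ (2 * r)) := by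
        rw [← Finset.mul_sum, Finset.sum_comm]
        congr 1
        refine Finset.sum_congr rfl fun σ _ => ?_
        rw [← hd, Finset.sum_mul, trace_sum]
    _ ≤ (2 * r + 1) * ∑ σ, v * trace (ranX H σ ^ (2 * r)) := by
        refine mul_le_mul_of_nonneg_left (Finset.sum_le_sum fun σ _ => ?_) (by positivity)
        simp only [trace, diag_apply, diagonal_mul]
        rw [Finset.mul_sum]
        exact Finset.sum_le_sum fun i _ => mul_le_mul_of_nonneg_right (hv i)
          (pow_even_diag_nonneg _ (ranX_sym H hH σ) r i)
    _ = _ := by rw [← Finset.mul_sum]; ring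

theorem aux_moment {ι κ : Type*} [Fintype ι] [DecidableEq ι] [Fintype κ] [DecidableEq κ] (H : κ → Matrix ι ι ℝ)
    (hH : ∀ k, (H k)ᵀ = H k) (d : ι → ℝ) (hd : ∑ k, H k * H k = diagonal d) (v : ℝ) (hv0 : 0 ≤ v)
    (hv : ∀ i, d i ≤ v) (p : ℕ) :
    ∑ σ, trace (ranX H σ ^ (2 * p)) ≤ (2 * p * v) ^ p * (2 ^ Fintype.card κ * Fintype.card ι) := by
  have : ∀ r, r ≤ p → ∑ σ, trace (ranX H σ ^ (2 * r)) ≤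
      (2 * p * v) ^ r * (2 ^ Fintype.card κ * Fintype.card ι) := by
    intro r
    induction r with
    | zero => intro _; simp
    | succ r ih =>
      intro hr
      have ih' := ih (by omega)
      have hr' : (r : ℝ) + 1 ≤ p := by exact_mod_cast hr
      refine (aux_step H hH d hd v hv r).trans ?_
      calc _ ≤ (2 * p * v) * ∑ σ, trace (ranX H σ ^ (2 * r)) := by
            refine mul_le_mul_of_nonneg_right (mul_le_mul_of_nonneg_right (by linarith) hv0) ?_
            exact Finset.sum_nonneg fun σ _ => Finset.sum_nonneg fun i _ =>
              pow_even_diag_nonneg _ (ranX_sym H hH σ) r i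
        _ ≤ (2 * p * v) * ((2 * p * v) ^ r * (2 ^ Fintype.card κ * Fintype.card ι)) :=
            mul_le_mul_of_nonneg_left ih' (by positivity)
        _ = _ := by ring
  exact this p le_rfl

/-- contraction -/
theorem aux_sup2 {V : Type*} [Fintype V] [Nonempty V] (h a b : V → ℝ)
    (hab : ∀ v v', |a v - a v'| ≤ |b v - b v'|) :
    (⨆ v, (h v + a v)) + (⨆ v, (h v - a v)) ≤ (⨆ v, (h v + b v)) + (⨆ v, (h v - b v)) := by
  have bdd : ∀ f : V → ℝ, BddAbove (Set.range f) := fun f => (Set.finite_range f).bddAbove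
  have key : ∀ v v', (h v + a v) + (h v' - a v') ≤
      (⨆ v, (h v + b v)) + (⨆ v, (h v - b v)) := by
    intro v v'
    have h1 : a v - a v' ≤ |b v - b v'| := (le_abs_self _).trans (hab v v')
    have p1 := le_ciSup (bdd fun v => h v + b v) v
    have p2 := le_ciSup (bdd fun v => h v + b v) v'
    have q1 := le_ciSup (bdd fun v => h v - b v) v
    have q2 := le_ciSup (bdd fun v => h v - b v) v'
    rcases abs_cases (b v - b v') with ⟨e, _⟩ | ⟨e, _⟩ <;> rw [e] at h1 <;> linarith
  have : (⨆ v, (h v + a v)) ≤ (⨆ v, (h v + b v)) + (⨆ v, (h v - b v)) - (⨆ v, (h v - a v)) := by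
    refine ciSup_le fun v => ?_
    have : (⨆ v, (h v - a v)) ≤ (⨆ v, (h v + b v)) + (⨆ v, (h v - b v)) - (h v + a v) :=
      ciSup_le fun v' => by linarith [key v v']
    linarith
  linarith

theorem sum_bool_cons {k : ℕ} (F : (Fin (k + 1) → Bool) → ℝ) :
    ∑ σ, F σ = ∑ τ : Fin k → Bool, (F (Fin.cons true τ) + F (Fin.cons false τ)) := by
  rw [← Equiv.sum_comp (Fin.consEquiv fun _ => Bool), Fintype.sum_prod_type,
    Fintype.sum_bool, ← Finset.sum_add_distrib]
  rfl

theorem aux_contraction {V : Type*} [Fintype V] [Nonempty V] (k : ℕ) :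
    ∀ (g : V → ℝ) (a b : Fin k → V → ℝ), (∀ i v v', |a i v - a i v'| ≤ |b i v - b i v'|) →
    ∑ σ : Fin k → Bool, (⨆ v, (g v + ∑ i, sg (σ i) * a i v)) ≤
      ∑ σ : Fin k → Bool, (⨆ v, (g v + ∑ i, sg (σ i) * b i v)) := by
  induction k with
  | zero => intro g a b _; simp
  | succ k ih =>
    intro g a b hab
    rw [sum_bool_cons, sum_bool_cons]
    simp only [Fin.sum_univ_succ, Fin.cons_zero, Fin.cons_succ]
    have s1 : sg true = 1 := by simp [sg]
    have s2 : sg false = -1 := by simp [sg]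
    simp only [s1, s2, one_mul, neg_one_mul, ← add_assoc]
    rw [Finset.sum_add_distrib]
    refine (add_le_add (ih (fun v => g v + a 0 v) (fun i => a i.succ) (fun i => b i.succ)
      fun i => hab _) (ih (fun v => g v + - a 0 v) (fun i => a i.succ) (fun i => b i.succ)
      fun i => hab _)).trans ?_
    rw [← Finset.sum_add_distrib]
    refine Finset.sum_le_sum fun τ _ => ?_
    have := aux_sup2 (fun v => g v + ∑ i, sg (τ i) * b i.succ v) (a 0) (b 0) (hab 0)
    simp only [sub_eq_add_neg] at this
    simpa only [add_right_comm] using this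

theorem aux_dual {n m : ℕ} (N M : Matrix (Fin n) (Fin m) ℝ) (L : ℝ)
    (hL : ∀ u v, 2 * (u ⬝ᵥ (M *ᵥ v)) ≤ L * (u ⬝ᵥ u + v ⬝ᵥ v)) :
    ∑ i, ∑ j, N i j * M i j ≤ L * traceNorm N := by
  set hA := Matrix.isHermitian_conjTranspose_mul_self N with hAdef
  set V : Matrix (Fin m) (Fin m) ℝ := (hA.eigenvectorUnitary : Matrix (Fin m) (Fin m) ℝ) with hV
  have h1 : Vᵀ * V = 1 := by
    have := Unitary.coe_star_mul_self hA.eigenvectorUnitary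
    rwa [Matrix.star_eq_conjTranspose, Matrix.conjTranspose_eq_transpose_of_trivial] at this
  have h2 : V * Vᵀ = 1 := mul_eq_one_comm.mp h1
  have h3 : Nᵀ * N = V * diagonal hA.eigenvalues * Vᵀ := by
    have := hA.spectral_theorem
    rw [Unitary.conjStarAlgAut_apply, Matrix.star_eq_conjTranspose] at this
    have e1 := Matrix.conjTranspose_eq_transpose_of_trivial N
    have e2 := Matrix.conjTranspose_eq_transpose_of_trivial V
    rw [← e1, ← e2]
    exact this
  have h4 : (N * V)ᵀ * (N * V) = diagonal hA.eigenvalues := by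
    calc (N * V)ᵀ * (N * V) = Vᵀ * (Nᵀ * N) * V := by
          rw [transpose_mul]; simp only [Matrix.mul_assoc]
      _ = (Vᵀ * V) * diagonal hA.eigenvalues * (Vᵀ * V) := by
          rw [h3]; simp only [Matrix.mul_assoc]
      _ = _ := by rw [h1, Matrix.one_mul, Matrix.mul_one]
  have h5 : ∑ i, ∑ j, N i j * M i j = trace ((N * V)ᵀ * (M * V)) := by
    have : (N * V)ᵀ * (M * V) = Vᵀ * (Nᵀ * M * V) := by
      rw [transpose_mul]; simp only [Matrix.mul_assoc]
    rw [this, trace_mul_comm, Matrix.mul_assoc, h2, Matrix.mul_one]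
    simp only [trace, diag_apply, Matrix.mul_apply, transpose_apply]
    exact Finset.sum_comm
  rw [h5, traceNorm, Finset.mul_sum]
  refine Finset.sum_le_sum fun j _ => ?_
  set a : Fin n → ℝ := fun i => (N * V) i j with ha
  set z : Fin m → ℝ := fun i => V i j with hz
  have e1 : a ⬝ᵥ a = hA.eigenvalues j := by
    have := congrFun (congrFun h4 j) j
    rw [diagonal_apply_eq, Matrix.mul_apply] at this
    exact this
  have e2 : z ⬝ᵥ z = 1 := by
    have := congrFun (congrFun h1 j) j
    rw [one_apply_eq, Matrix.mul_apply] at this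
    exact this
  have e3 : ((N * V)ᵀ * (M * V)).diag j = a ⬝ᵥ (M *ᵥ z) := by
    rw [diag_apply, Matrix.mul_apply]; rfl
  rw [e3]
  have hnn : 0 ≤ hA.eigenvalues j := by
    rw [← e1]; exact Finset.sum_nonneg fun i _ => mul_self_nonneg _
  rcases hnn.eq_or_lt with h0 | h0
  · have : a = 0 := by rw [← h0] at e1; exact dotProduct_self_eq_zero.1 e1
    rw [this, ← h0]; simp
  · set c := Real.sqrt (hA.eigenvalues j) with hc
    have hcpos : 0 < c := Real.sqrt_pos.2 h0
    have hcc : c * c = hA.eigenvalues j := Real.mul_self_sqrt hnn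
    have := hL a (c • z)
    rw [mulVec_smul, dotProduct_smul, dotProduct_smul, smul_dotProduct, e1, e2] at this
    simp only [smul_eq_mul, mul_one, hcc] at this
    rw [← hcc] at this
    have h6 : c * (a ⬝ᵥ (M *ᵥ z)) ≤ c * (L * c) := by linarith
    exact le_of_mul_le_mul_left h6 hcpos

def dil {n m : ℕ} (q : Fin n × Fin m) (w : ℝ) : Matrix (Fin n ⊕ Fin m) (Fin n ⊕ Fin m) ℝ :=
  Matrix.fromBlocks 0 (Matrix.single q.1 q.2 w) (Matrix.single q.2 q.1 w) 0

theorem dil_sym {n m : ℕ} (q : Fin n × Fin m) (w : ℝ) : (dil q w)ᵀ = dil q w := by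
  simp [dil, fromBlocks_transpose]

theorem dil_sq {n m : ℕ} (q : Fin n × Fin m) (w : ℝ) : dil q w * dil q w =
    diagonal (Sum.elim (fun i => if q.1 = i then w ^ 2 else 0)
      (fun j => if q.2 = j then w ^ 2 else 0)) := by
  rw [← fromBlocks_diagonal]
  simp only [dil, fromBlocks_multiply]
  simp only [Matrix.zero_mul, Matrix.mul_zero, zero_add, add_zero, single_mul_single_same]
  congr 1
  · ext i j
    simp only [single_apply, diagonal_apply]
    grind
  · ext i j
    simp only [single_apply, diagonal_apply]
    grind

theorem aux_rad {n m s : ℕ} (hm : 2 ≤ m) (hmn : m ≤ n) (q : Fin s → Fin n × Fin m)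
    (w : Fin s → ℝ) (x : ℝ) (hx0 : 0 ≤ x)
    (hrow : ∀ i, ∑ k, (if (q k).1 = i then w k ^ 2 else 0) ≤ x)
    (hcol : ∀ j, ∑ k, (if (q k).2 = j then w k ^ 2 else 0) ≤ x)
    {V : Type*} [Fintype V] [Nonempty V] (N : V → Matrix (Fin n) (Fin m) ℝ) (R : ℝ) (hR : 0 ≤ R)
    (hN : ∀ v, traceNorm (N v) ≤ R) :
    ∑ σ : Fin s → Bool, (⨆ v, ∑ k, sg (σ k) * (w k * N v (q k).1 (q k).2)) ≤
      2 ^ s * (R * Real.sqrt (24 * x * Real.log n)) := by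
  have hn2 : (2 : ℝ) ≤ n := by exact_mod_cast hm.trans hmn
  have hlog2 : 0.69 < Real.log 2 := by linarith [Real.log_two_gt_d9]
  have hlogn : Real.log 2 ≤ Real.log n := Real.log_le_log (by norm_num) hn2
  set H : Fin s → Matrix (Fin n ⊕ Fin m) (Fin n ⊕ Fin m) ℝ := fun k => dil (q k) (w k) with hH
  have hHs : ∀ k, (H k)ᵀ = H k := fun k => dil_sym _ _
  set p : ℕ := ⌈Real.log (2 * n)⌉₊ with hp
  have hl2n : Real.log (2 * n) = Real.log 2 + Real.log n :=
    Real.log_mul (by norm_num) (by linarith)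
  have hp1 : 1 ≤ p := Nat.one_le_ceil_iff.2 (by rw [hl2n]; linarith)
  have hp2 : (p : ℝ) ≤ 4 * Real.log n := by
    have := Nat.ceil_lt_add_one (a := Real.log (2 * n)) (by rw [hl2n]; linarith)
    rw [← hp, hl2n] at this
    linarith
  have hp3 : (2 * n : ℝ) ≤ Real.exp 1 ^ p := by
    rw [← Real.exp_nat_mul, mul_one]
    calc (2 * n : ℝ) = Real.exp (Real.log (2 * n)) := (Real.exp_log (by linarith)).symm
      _ ≤ _ := Real.exp_le_exp.2 (Nat.le_ceil _)
  have hmom := aux_moment H hHs (Sum.elim (fun i => ∑ k, if (q k).1 = i then w k ^ 2 else 0)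
      (fun j => ∑ k, if (q k).2 = j then w k ^ 2 else 0)) (by
        simp only [hH, dil_sq]
        ext a b
        rw [Matrix.sum_apply]
        by_cases hab : a = b
        · subst hab
          rcases a with a | a <;> simp
        · rw [diagonal_apply_ne _ hab]; exact Finset.sum_eq_zero fun k _ => diagonal_apply_ne _ hab) x hx0 (by rintro (i | j) <;> simp [hrow, hcol]) p
  set T : (Fin s → Bool) → ℝ := fun σ => trace (ranX H σ ^ (2 * p)) with hT
  have hT0 : ∀ σ, 0 ≤ T σ := fun σ => Finset.sum_nonneg fun i _ =>
    pow_even_diag_nonneg _ (ranX_sym H hHs σ) p i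
  set L : (Fin s → Bool) → ℝ := fun σ => (T σ) ^ ((((2 * p : ℕ) : ℝ))⁻¹) with hLdef
  have hL0 : ∀ σ, 0 ≤ L σ := fun σ => Real.rpow_nonneg (hT0 σ) _
  have hLp : ∀ σ, L σ ^ (2 * p) = T σ := fun σ => Real.rpow_inv_natCast_pow (hT0 σ) (by omega)
  -- per-sign bound
  have hper : ∀ σ v, ∑ k, sg (σ k) * (w k * N v (q k).1 (q k).2) ≤ R * L σ := by
    intro σ v
    have := aux_dual (N v) (∑ k, Matrix.single (q k).1 (q k).2 (sg (σ k) * w k)) (L σ) (by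
      intro y z
      have hq := aux_quad (ranX H σ) (ranX_sym H hHs σ) p hp1 (L σ) (hL0 σ) (hLp σ).ge
        (Sum.elim y z)
      have e1 : Sum.elim y z ⬝ᵥ Sum.elim y z = y ⬝ᵥ y + z ⬝ᵥ z := by
        simp [dotProduct]
      have e2 : Sum.elim y z ⬝ᵥ (ranX H σ *ᵥ Sum.elim y z) = 
          2 * (y ⬝ᵥ ((∑ k, Matrix.single (q k).1 (q k).2 (sg (σ k) * w k)) *ᵥ z)) := by
        rw [ranX, sum_mulVec, sum_mulVec, dotProduct_sum, dotProduct_sum, Finset.mul_sum]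
        refine Finset.sum_congr rfl fun k _ => ?_
        rw [hH]
        simp only [dil, smul_mulVec, fromBlocks_mulVec, dotProduct_smul]
        simp [single_mulVec, dotProduct, Function.update_apply, smul_eq_mul]
        ring
      rw [e1, e2] at hq
      exact hq)
    have e3 : ∑ i, ∑ j, N v i j * (∑ k, Matrix.single (q k).1 (q k).2 (sg (σ k) * w k)) i j =
        ∑ k, sg (σ k) * (w k * N v (q k).1 (q k).2) := by
      simp only [Matrix.sum_apply, Finset.mul_sum]
      calc _ = ∑ i, ∑ k, ∑ j, N v i j * Matrix.single (q k).1 (q k).2 (sg (σ k) * w k) i j :=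
            Finset.sum_congr rfl fun i _ => Finset.sum_comm
        _ = ∑ k, ∑ i, ∑ j, N v i j * Matrix.single (q k).1 (q k).2 (sg (σ k) * w k) i j :=
            Finset.sum_comm
        _ = _ := by
          refine Finset.sum_congr rfl fun k _ => ?_
          simp only [single_apply, mul_ite, mul_zero, ite_and]
          simp
          ring
    rw [e3] at this
    calc _ ≤ L σ * traceNorm (N v) := this
      _ ≤ L σ * R := mul_le_mul_of_nonneg_left (hN v) (hL0 σ)
      _ = _ := mul_comm _ _
  -- Jensen
  have hcard : (Fintype.card (Fin s → Bool) : ℝ) = 2 ^ s := by simp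
  have h2s : (0 : ℝ) < 2 ^ s := by positivity
  have hjen : (∑ σ : Fin s → Bool, (1 / 2 ^ s : ℝ) * L σ) ^ (2 * p) ≤
      ∑ σ : Fin s → Bool, (1 / 2 ^ s : ℝ) * L σ ^ (2 * p) :=
    Real.pow_arith_mean_le_arith_mean_pow _ _ _ (fun _ _ => by positivity)
      (by rw [Finset.sum_const, nsmul_eq_mul, Finset.card_univ, hcard]; field_simp)
      (fun σ _ => hL0 σ) _
  have hQ : (∑ σ : Fin s → Bool, (1 / 2 ^ s : ℝ) * L σ) ≤ Real.sqrt (24 * x * Real.log n) := by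
    refine le_of_pow_le_pow_left₀ (n := 2 * p) (by omega) (Real.sqrt_nonneg _) ?_
    refine hjen.trans ?_
    simp only [hLp, ← Finset.mul_sum]
    have hx24 : 0 ≤ 24 * x * Real.log n := by
      have : 0 ≤ Real.log n := by linarith
      positivity
    rw [pow_mul (Real.sqrt _), Real.sq_sqrt hx24]
    have hcd : (Fintype.card (Fin n ⊕ Fin m) : ℝ) ≤ 2 * n := by
      have : (m : ℝ) ≤ n := by exact_mod_cast hmn
      simp; linarith
    calc (1 / 2 ^ s : ℝ) * ∑ σ, T σ ≤ (1 / 2 ^ s : ℝ) * ((2 * p * x) ^ p *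
          (2 ^ Fintype.card (Fin s) * Fintype.card (Fin n ⊕ Fin m))) :=
          mul_le_mul_of_nonneg_left hmom (by positivity)
      _ = (2 * p * x) ^ p * Fintype.card (Fin n ⊕ Fin m) := by
          rw [Fintype.card_fin]; field_simp
      _ ≤ (2 * p * x) ^ p * Real.exp 1 ^ p :=
          mul_le_mul_of_nonneg_left (hcd.trans hp3) (by positivity)
      _ = (2 * p * x * Real.exp 1) ^ p := by rw [← mul_pow]
      _ ≤ _ := by
          refine pow_le_pow_left₀ (by positivity) ?_ _
          have he : Real.exp 1 ≤ 3 := by linarith [Real.exp_one_lt_d9]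
          calc 2 * p * x * Real.exp 1 ≤ 2 * p * x * 3 :=
                mul_le_mul_of_nonneg_left he (by positivity)
            _ = 6 * x * p := by ring
            _ ≤ 6 * x * (4 * Real.log n) := mul_le_mul_of_nonneg_left hp2 (by positivity)
            _ = _ := by ring
  calc _ ≤ ∑ σ : Fin s → Bool, R * L σ := Finset.sum_le_sum fun σ _ => ciSup_le fun v => hper σ v
    _ = 2 ^ s * (R * ∑ σ : Fin s → Bool, (1 / 2 ^ s : ℝ) * L σ) := by
        rw [← Finset.mul_sum, ← Finset.mul_sum]; field_simp
    _ ≤ _ := by gcongr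

def Bset {s : ℕ} (e : Fin s × Bool ≃ Fin (2 * s)) (σ : Fin s → Bool) : Finset (Fin (2 * s)) :=
  Finset.univ.filter fun t => σ (e.symm t).1 = (e.symm t).2

theorem Bset_sum {s : ℕ} (e : Fin s × Bool ≃ Fin (2 * s)) (σ : Fin s → Bool)
    (f : Fin (2 * s) → ℝ) : ∑ t ∈ Bset e σ, f t = ∑ k, f (e (k, σ k)) := by
  rw [Bset, Finset.sum_filter, ← Equiv.sum_comp e, Fintype.sum_prod_type]
  refine Finset.sum_congr rfl fun k _ => ?_
  simp

theorem Bset_compl {s : ℕ} (e : Fin s × Bool ≃ Fin (2 * s)) (σ : Fin s → Bool) :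
    (Bset e σ)ᶜ = Bset e (fun k => !σ k) := by
  ext t
  simp only [Bset, mem_compl, mem_filter, mem_univ, true_and]
  cases σ (e.symm t).1 <;> cases (e.symm t).2 <;> simp

theorem Bset_card {s : ℕ} (e : Fin s × Bool ≃ Fin (2 * s)) (σ : Fin s → Bool) :
    (Bset e σ).card = s := by
  have := Bset_sum e σ (fun _ => 1)
  simp at this
  exact this

theorem Bset_map {s : ℕ} (e : Fin s × Bool ≃ Fin (2 * s)) (σ : Fin s → Bool)
    (π : Equiv.Perm (Fin (2 * s))) :
    (Bset e σ).map π.toEmbedding = Bset (e.trans π) σ := by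
  ext t
  simp only [Finset.mem_map_equiv, Bset, mem_filter, mem_univ, true_and]
  exact Iff.rfl

theorem Bset_swap {s : ℕ} (e : Fin s × Bool ≃ Fin (2 * s)) (σ : Fin s → Bool) :
    Bset e (fun k => !σ k) =
      Bset (((Equiv.refl (Fin s)).prodCongr Equiv.boolNot).trans e) σ := by
  ext t
  simp only [Bset, mem_filter, mem_univ, true_and, Equiv.symm_trans_apply]
  simp

theorem exists_perm_finset {α : Type*} [Fintype α] [DecidableEq α] (A B : Finset α)
    (h : A.card = B.card) : ∃ τ : Equiv.Perm α, A.map τ.toEmbedding = B := by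
  have e : {x // x ∈ A} ≃ {x // x ∈ B} := Finset.equivOfCardEq h
  refine ⟨e.extendSubtype, ?_⟩
  refine Finset.eq_of_subset_of_card_le ?_ (by rw [card_map, h])
  intro x hx
  obtain ⟨y, hy, rfl⟩ := Finset.mem_map.1 hx
  exact e.extendSubtype_mem y hy

theorem Esplit_perm {s : ℕ} (F : Finset (Fin (2 * s)) → ℝ) (B0 : Finset (Fin (2 * s)))
    (h0 : B0.card = s) :
    ∑ π : Equiv.Perm (Fin (2 * s)), F (B0.map π.toEmbedding) =
      (Fintype.card (Equiv.Perm (Fin (2 * s))) : ℝ) * Esplit s F := by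
  set A := Finset.univ.filter (fun B : Finset (Fin (2 * s)) => B.card = s) with hA
  have hAcard : A.card = Nat.choose (2 * s) s := by
    have : A = Finset.powersetCard s Finset.univ := by
      ext B; simp [hA]
    rw [this, card_powersetCard]; simp
  have hpos : (0 : ℝ) < Nat.choose (2 * s) s := by
    exact_mod_cast Nat.choose_pos (by omega)
  have h1 : ∀ π : Equiv.Perm (Fin (2 * s)), ∑ B ∈ A, F (B.map π.toEmbedding) = ∑ B ∈ A, F B := by
    intro π
    refine Finset.sum_bij' (fun B _ => B.map π.toEmbedding) (fun B _ => B.map π.symm.toEmbedding)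
      ?_ ?_ ?_ ?_ ?_
    · intro B hB; simpa [hA] using hB
    · intro B hB; simpa [hA] using hB
    · intro B _; ext t; simp [Finset.mem_map_equiv]
    · intro B _; ext t; simp [Finset.mem_map_equiv]
    · intro B _; rfl
  have h2 : ∀ B ∈ A, ∑ π : Equiv.Perm (Fin (2 * s)), F (B.map π.toEmbedding) =
      ∑ π : Equiv.Perm (Fin (2 * s)), F (B0.map π.toEmbedding) := by
    intro B hB
    have hB' : B.card = s := by simpa [hA] using hB
    obtain ⟨τ, hτ⟩ := exists_perm_finset B0 B (h0.trans hB'.symm)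
    rw [← Equiv.sum_comp (Equiv.mulRight τ)
      (fun π : Equiv.Perm (Fin (2 * s)) => F (B0.map π.toEmbedding))]
    refine Finset.sum_congr rfl fun π _ => ?_
    rw [← hτ, Finset.map_map]
    rfl
  have h3 : ∑ B ∈ A, ∑ π : Equiv.Perm (Fin (2 * s)), F (B.map π.toEmbedding) =
      ∑ π : Equiv.Perm (Fin (2 * s)), ∑ B ∈ A, F (B.map π.toEmbedding) := Finset.sum_comm
  rw [Finset.sum_congr rfl h2, Finset.sum_congr rfl fun π _ => h1 π, Finset.sum_const,
    Finset.sum_const, hAcard, nsmul_eq_mul, nsmul_eq_mul, Finset.card_univ] at h3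
  rw [Esplit, ← mul_div_assoc, ← hA, ← h3]
  field_simp

theorem Esplit_le {s : ℕ} (F : Finset (Fin (2 * s)) → ℝ) (K : ℝ)
    (h : ∀ e : Fin s × Bool ≃ Fin (2 * s), ∑ σ : Fin s → Bool, F (Bset e σ) ≤ 2 ^ s * K) :
    Esplit s F ≤ K := by
  obtain ⟨e⟩ : Nonempty (Fin s × Bool ≃ Fin (2 * s)) :=
    ⟨Fintype.equivOfCardEq (by simp [mul_comm])⟩
  set P : ℝ := (Fintype.card (Equiv.Perm (Fin (2 * s))) : ℝ) with hP
  have hPpos : 0 < P := by rw [hP]; exact_mod_cast Fintype.card_pos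
  have h1 : ∑ σ : Fin s → Bool, ∑ π : Equiv.Perm (Fin (2 * s)),
      F ((Bset e σ).map π.toEmbedding) = 2 ^ s * (P * Esplit s F) := by
    rw [Finset.sum_congr rfl fun σ _ => Esplit_perm F (Bset e σ) (Bset_card e σ)]
    simp [hP]
  have h2 : ∑ σ : Fin s → Bool, ∑ π : Equiv.Perm (Fin (2 * s)),
      F ((Bset e σ).map π.toEmbedding) ≤ P * (2 ^ s * K) := by
    rw [Finset.sum_comm]
    calc _ ≤ ∑ π : Equiv.Perm (Fin (2 * s)), 2 ^ s * K := by
          refine Finset.sum_le_sum fun π _ => ?_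
          simp only [Bset_map]
          exact h _
      _ = _ := by rw [Finset.sum_const, nsmul_eq_mul, Finset.card_univ]
  rw [h1] at h2
  have : 2 ^ s * P * Esplit s F ≤ 2 ^ s * P * K := by linarith
  exact le_of_mul_le_mul_left this (by positivity)

theorem Esplit_mono {s : ℕ} (F G : Finset (Fin (2 * s)) → ℝ)
    (h : ∀ B, B.card = s → F B ≤ G B) : Esplit s F ≤ Esplit s G := by
  unfold Esplit
  refine div_le_div_of_nonneg_right (Finset.sum_le_sum fun B hB => h B ?_) (by positivity)
  simpa using hB

/-- bound for one pairing -/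
theorem aux_pair {n m s : ℕ} (hm : 2 ≤ m) (hmn : m ≤ n) (Sbar : Fin (2 * s) → Fin n × Fin m)
    (good : Fin (2 * s) → Prop) (w : Fin (2 * s) → ℝ) (x : ℝ) (hx0 : 0 ≤ x)
    (hrow : ∀ i, ∑ t, (if (Sbar t).1 = i then w t ^ 2 else 0) ≤ x)
    (hcol : ∀ j, ∑ t, (if (Sbar t).2 = j then w t ^ 2 else 0) ≤ x)
    {V : Type*} [Fintype V] [Nonempty V] (N : V → Matrix (Fin n) (Fin m) ℝ) (R : ℝ) (hR : 0 ≤ R)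
    (hN : ∀ v, traceNorm (N v) ≤ R) (f : Fin (2 * s) → V → ℝ) (l b : ℝ) (hl : 0 ≤ l)
    (hlip : ∀ t, good t → ∀ v v', |f t v - f t v'| ≤
      l * |w t * N v (Sbar t).1 (Sbar t).2 - w t * N v' (Sbar t).1 (Sbar t).2|)
    (hb : ∀ t v, 0 ≤ f t v ∧ f t v ≤ b) (e : Fin s × Bool ≃ Fin (2 * s)) :
    ∑ σ : Fin s → Bool, (⨆ v, (∑ t ∈ Bset e σ, f t v - ∑ t ∈ (Bset e σ)ᶜ, f t v)) ≤
      2 ^ s * (2 * (l * (R * Real.sqrt (24 * x * Real.log n))) +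
        b * (Finset.univ.filter fun t => ¬ good t).card) := by
  have bdd : ∀ f : V → ℝ, BddAbove (Set.range f) := fun f => (Set.finite_range f).bddAbove
  set g : Fin (2 * s) → V → ℝ := fun t v => if good t then f t v else 0 with hg
  set D : ℝ := b * (Finset.univ.filter fun t => ¬ good t).card with hD
  have hhalf : ∀ (c : Bool) (τ : ℝ), |τ| = 1 →
      ∑ σ : Fin s → Bool, (⨆ v, ∑ k, sg (σ k) * (τ * g (e (k, c)) v)) ≤
      2 ^ s * (l * (R * Real.sqrt (24 * x * Real.log n))) := by
    intro c τ hτ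
    have h1 := aux_contraction (V := V) s (fun _ => 0) (fun k v => τ * g (e (k, c)) v)
      (fun k v => l * (w (e (k, c)) * N v (Sbar (e (k, c))).1 (Sbar (e (k, c))).2)) (by
        intro k v v'
        simp only [← mul_sub, abs_mul, hτ, one_mul]
        rw [abs_of_nonneg hl]
        simp only [hg]
        split_ifs with hgood
        · have := hlip _ hgood v v'
          rwa [← mul_sub, abs_mul] at this
        · simp; positivity)
    simp only [zero_add] at h1
    refine h1.trans ?_
    have hsub : ∀ (P : Fin (2 * s) → ℝ), (∀ t, 0 ≤ P t) → ∑ k, P (e (k, c)) ≤ ∑ t, P t := by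
      intro P hP
      rw [← Equiv.sum_comp e, Fintype.sum_prod_type]
      exact Finset.sum_le_sum fun k _ =>
        Finset.single_le_sum (f := fun c => P (e (k, c))) (fun c _ => hP _) (mem_univ c)
    have h2 := aux_rad hm hmn (fun k => Sbar (e (k, c))) (fun k => w (e (k, c))) x hx0
      (fun i => (hsub (fun t => if (Sbar t).1 = i then w t ^ 2 else 0)
        (fun t => by positivity)).trans (hrow i))
      (fun j => (hsub (fun t => if (Sbar t).2 = j then w t ^ 2 else 0)
        (fun t => by positivity)).trans (hcol j)) N R hR hN
    have h3 : ∀ σ : Fin s → Bool, (⨆ v, ∑ k, sg (σ k) *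
        (l * (w (e (k, c)) * N v (Sbar (e (k, c))).1 (Sbar (e (k, c))).2))) =
        l * (⨆ v, ∑ k, sg (σ k) * (w (e (k, c)) * N v (Sbar (e (k, c))).1 (Sbar (e (k, c))).2)) := by
      intro σ
      rw [Real.mul_iSup_of_nonneg hl]
      congr 1; ext v
      rw [Finset.mul_sum]
      exact Finset.sum_congr rfl fun k _ => by ring
    rw [Finset.sum_congr rfl fun σ _ => h3 σ, ← Finset.mul_sum]
    calc _ ≤ l * (2 ^ s * (R * Real.sqrt (24 * x * Real.log n))) :=
          mul_le_mul_of_nonneg_left h2 hl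
      _ = _ := by ring
  have hper : ∀ σ : Fin s → Bool,
      (⨆ v, (∑ t ∈ Bset e σ, f t v - ∑ t ∈ (Bset e σ)ᶜ, f t v)) ≤
      (⨆ v, ∑ k, sg (σ k) * (1 * g (e (k, true)) v)) +
      (⨆ v, ∑ k, sg (σ k) * (-1 * g (e (k, false)) v)) + D := by
    intro σ
    refine ciSup_le fun v => ?_
    have p1 := le_ciSup (bdd fun v => ∑ k, sg (σ k) * (1 * g (e (k, true)) v)) v
    have p2 := le_ciSup (bdd fun v => ∑ k, sg (σ k) * (-1 * g (e (k, false)) v)) v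
    have p3 : ∑ t ∈ Bset e σ, f t v - ∑ t ∈ (Bset e σ)ᶜ, f t v ≤
        (∑ t ∈ Bset e σ, g t v - ∑ t ∈ (Bset e σ)ᶜ, g t v) + D := by
      have q1 : ∀ t, g t v ≤ f t v := by
        intro t; simp only [hg]; split_ifs
        · exact le_rfl
        · exact (hb t v).1
      have q2 : ∑ t ∈ Bset e σ, (f t v - g t v) ≤ D := by
        calc _ ≤ ∑ t, (f t v - g t v) := Finset.sum_le_sum_of_subset_of_nonneg
              (Finset.subset_univ _) fun t _ _ => sub_nonneg.2 (q1 t)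
          _ ≤ ∑ t, (if ¬ good t then b else 0) := by
              refine Finset.sum_le_sum fun t _ => ?_
              simp only [hg]
              split_ifs with h1 <;> simp [(hb t v).2]
          _ = D := by
              rw [← Finset.sum_filter, Finset.sum_const, nsmul_eq_mul, hD, mul_comm]
      rw [Finset.sum_sub_distrib] at q2
      have q3 : ∑ t ∈ (Bset e σ)ᶜ, g t v ≤ ∑ t ∈ (Bset e σ)ᶜ, f t v :=
        Finset.sum_le_sum fun t _ => q1 t
      linarith
    have p4 : ∑ t ∈ Bset e σ, g t v - ∑ t ∈ (Bset e σ)ᶜ, g t v =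
        ∑ k, sg (σ k) * (1 * g (e (k, true)) v) + ∑ k, sg (σ k) * (-1 * g (e (k, false)) v) := by
      rw [Bset_compl, Bset_sum, Bset_sum, ← Finset.sum_sub_distrib, ← Finset.sum_add_distrib]
      refine Finset.sum_congr rfl fun k _ => ?_
      cases σ k <;> simp [sg] <;> ring
    rw [p4] at p3
    linarith
  refine (Finset.sum_le_sum fun σ _ => hper σ).trans ?_
  rw [Finset.sum_add_distrib, Finset.sum_add_distrib, Finset.sum_const, nsmul_eq_mul,
    Finset.card_univ]
  have a1 := hhalf true 1 (by simp)
  have a2 := hhalf false (-1) (by simp)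
  have a3 : ((Fintype.card (Fin s → Bool) : ℕ) : ℝ) * D = 2 ^ s * D := by simp
  rw [a3]
  linarith

theorem cnt_bad {α : Type*} [Fintype α] [DecidableEq α] {s : ℕ} (hs : 1 ≤ s) (u : Fin (2 * s) → α)
    (c : α → ℝ) (hc : ∀ a, c a = ((Finset.univ.filter fun t => u t = a).card : ℝ) / (2 * (s : ℝ)))
    (θ : ℝ) (hθ : 0 ≤ θ) :
    ((Finset.univ.filter fun t => c (u t) < θ).card : ℝ) ≤ Fintype.card α * (2 * s * θ) := by
  have hs' : (0 : ℝ) < 2 * s := by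
    have : (0 : ℝ) < s := by exact_mod_cast hs
    linarith
  rw [Finset.card_eq_sum_card_fiberwise (t := Finset.univ) (f := u) (fun _ _ => by simp)]
  push_cast
  calc _ ≤ ∑ a : α, 2 * s * θ := by
        refine Finset.sum_le_sum fun a _ => ?_
        by_cases ha : c a < θ
        · have h1 : ((Finset.univ.filter fun t => u t = a).card : ℝ) = 2 * s * c a := by
            rw [hc]; field_simp
          calc _ ≤ ((Finset.univ.filter fun t => u t = a).card : ℝ) := by
                exact_mod_cast Finset.card_le_card fun t ht => by
                  simp only [mem_filter, mem_univ, true_and] at ht ⊢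
                  exact ht.2
            _ ≤ _ := by rw [h1]; exact mul_le_mul_of_nonneg_left ha.le hs'.le
        · have : (((Finset.univ.filter fun t => c (u t) < θ).filter fun t => u t = a)) = ∅ := by
            ext t
            simp only [mem_filter, mem_univ, true_and, notMem_empty, iff_false, not_and]
            rintro h rfl
            exact ha h
          rw [this]; simp; positivity
    _ = _ := by simp

theorem cnt_row {α : Type*} [Fintype α] [DecidableEq α] {s : ℕ} (hs : 1 ≤ s) (u : Fin (2 * s) → α)
    (c : α → ℝ) (hc : ∀ a, c a = ((Finset.univ.filter fun t => u t = a).card : ℝ) / (2 * (s : ℝ)))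
    (K : ℝ) (hK : 0 ≤ K) (y : Fin (2 * s) → ℝ) (hy : ∀ t, y t ≤ K * (c (u t))⁻¹) (a : α) :
    ∑ t, (if u t = a then y t else 0) ≤ 2 * s * K := by
  have hs' : (0 : ℝ) < 2 * s := by
    have : (0 : ℝ) < s := by exact_mod_cast hs
    linarith
  have h1 : ((Finset.univ.filter fun t => u t = a).card : ℝ) = 2 * s * c a := by
    rw [hc]; field_simp
  calc _ ≤ ∑ t, (if u t = a then K * (c a)⁻¹ else 0) := by
        refine Finset.sum_le_sum fun t _ => ?_
        split_ifs with h
        · rw [← h]; exact hy t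
        · exact le_rfl
    _ = 2 * s * K * (c a * (c a)⁻¹) := by
        rw [← Finset.sum_filter, Finset.sum_const, nsmul_eq_mul, h1]; ring
    _ ≤ 2 * s * K * 1 := by
        refine mul_le_mul_of_nonneg_left ?_ (by positivity)
        exact mul_inv_le_one
    _ = _ := by ring

/-- transductive analogue of the cube-root bound, with unsmoothed empirical
marginals of `S̄` and no further assumptions. Any empirical risk minimizer over `W_p̄`
satisfies, in expectation over the random split,
`E[L̂_T(X̂_S) − inf_{X ∈ W_p̄} L̂_T(X)] ≤ C·(l+b)·(r n log n / s)^{1/3}`. -/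
theorem transductive_cubeRoot_bound :
    ∃ C : ℝ, 0 < C ∧
      ∀ (n m s : ℕ) (r l b : ℝ) (ℓ : ℝ → ℝ → ℝ) (Y : Matrix (Fin n) (Fin m) ℝ)
        (Sbar : Fin (2 * s) → Fin n × Fin m)
        (Xhat : Finset (Fin (2 * s)) → Matrix (Fin n) (Fin m) ℝ),
        2 ≤ m → m ≤ n → 1 ≤ r → 0 ≤ l → 0 ≤ b → 1 ≤ s →
        LipLoss l ℓ →
        (∀ x y, 0 ≤ ℓ x y ∧ ℓ x y ≤ b) →
        (∀ B : Finset (Fin (2 * s)), B.card = s →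
          Xhat B ∈ Wball (ubarR Sbar) (ubarC Sbar) r ∧
          ∀ X ∈ Wball (ubarR Sbar) (ubarC Sbar) r,
            empRiskOn ℓ Y Sbar B (Xhat B) ≤ empRiskOn ℓ Y Sbar B X) →
        Esplit s (fun B =>
            empRiskOn ℓ Y Sbar Bᶜ (Xhat B) -
              sInf ((fun X => empRiskOn ℓ Y Sbar Bᶜ X) ''
                Wball (ubarR Sbar) (ubarC Sbar) r)) ≤
          C * (l + b) * (r * n * Real.log n / s) ^ ((1 : ℝ) / 3) := by
  refine ⟨28, by norm_num, ?_⟩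
  intro n m s r l b ℓ Y Sbar Xhat hm hmn hr hl hb0 hs hLip hbd hX
  have hsR : (0 : ℝ) < s := by exact_mod_cast hs
  have hn2 : (2 : ℝ) ≤ n := by exact_mod_cast hm.trans hmn
  have hnpos : (0 : ℝ) < n := by linarith
  have hlogn : 0 < Real.log n := Real.log_pos (by linarith)
  set ρ : ℝ := r * n * Real.log n / s with hρ
  have hρpos : 0 < ρ := by
    have : 0 < r := by linarith
    positivity
  set δ : ℝ := ρ ^ ((1 : ℝ) / 3) with hδ
  have hδpos : 0 < δ := Real.rpow_pos_of_pos hρpos _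
  have hδ3 : δ ^ 3 = ρ := by
    rw [hδ, ← Real.rpow_natCast, ← Real.rpow_mul hρpos.le]; norm_num
  refine le_of_forall_pos_le_add fun η hη => ?_
  set W := Wball (ubarR Sbar) (ubarC Sbar) r with hW
  -- near minimizers on the test half
  have hstar : ∀ B : Finset (Fin (2 * s)), ∃ X, B.card = s → X ∈ W ∧
      empRiskOn ℓ Y Sbar Bᶜ X ≤ sInf ((fun X => empRiskOn ℓ Y Sbar Bᶜ X) '' W) + η := by
    intro B
    by_cases hB : B.card = s
    · have hne : ((fun X => empRiskOn ℓ Y Sbar Bᶜ X) '' W).Nonempty := ⟨_, _, (hX B hB).1, rfl⟩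
      obtain ⟨_, ⟨X, hXW, rfl⟩, hlt⟩ := exists_lt_of_csInf_lt hne (lt_add_of_pos_right _ hη)
      exact ⟨X, fun _ => ⟨hXW, hlt.le⟩⟩
    · exact ⟨0, fun h => absurd h hB⟩
  choose Xstar hXstar using hstar
  let V := {B : Finset (Fin (2 * s)) // B.card = s} × Bool
  let XV : V → Matrix (Fin n) (Fin m) ℝ := fun v => if v.2 then Xhat v.1.1 else Xstar v.1.1
  have hXV : ∀ v, XV v ∈ W := by
    rintro ⟨⟨B, hB⟩, c⟩
    cases c
    · exact (hXstar B hB).1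
    · exact (hX B hB).1
  have : Nonempty V := by
    obtain ⟨B, -, hB⟩ := Finset.exists_subset_card_eq
      (s := (Finset.univ : Finset (Fin (2 * s)))) (n := s) (by simp; omega)
    exact ⟨⟨⟨B, hB⟩, true⟩⟩
  have bdd : ∀ f : V → ℝ, BddAbove (Set.range f) := fun f => (Set.finite_range f).bddAbove
  let f : Fin (2 * s) → V → ℝ := fun t v =>
    ℓ (XV v (Sbar t).1 (Sbar t).2) (Y (Sbar t).1 (Sbar t).2)
  let F : Finset (Fin (2 * s)) → ℝ := fun B => ⨆ v, (∑ t ∈ B, f t v - ∑ t ∈ Bᶜ, f t v)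
  let good : Fin (2 * s) → Prop := fun t =>
    δ / n ≤ ubarR Sbar (Sbar t).1 ∧ δ / n ≤ ubarC Sbar (Sbar t).2
  let w : Fin (2 * s) → ℝ := fun t => if good t then
    (Real.sqrt (ubarR Sbar (Sbar t).1))⁻¹ * (Real.sqrt (ubarC Sbar (Sbar t).2))⁻¹ else 0
  let N : V → Matrix (Fin n) (Fin m) ℝ := fun v =>
    Matrix.diagonal (fun i => Real.sqrt (ubarR Sbar i)) * XV v *
      Matrix.diagonal (fun j => Real.sqrt (ubarC Sbar j))
  have hNtr : ∀ v, traceNorm (N v) ≤ Real.sqrt r := fun v => hXV v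
  have hθ : 0 < δ / n := by positivity
  have hR0 : ∀ i, 0 ≤ ubarR Sbar i := fun i => by unfold ubarR; positivity
  have hC0 : ∀ j, 0 ≤ ubarC Sbar j := fun j => by unfold ubarC; positivity
  have hwN : ∀ t, good t → ∀ v, w t * N v (Sbar t).1 (Sbar t).2 = XV v (Sbar t).1 (Sbar t).2 := by
    intro t ht v
    have h1 : Real.sqrt (ubarR Sbar (Sbar t).1) ≠ 0 := (Real.sqrt_pos.2 (hθ.trans_le ht.1)).ne'
    have h2 : Real.sqrt (ubarC Sbar (Sbar t).2) ≠ 0 := (Real.sqrt_pos.2 (hθ.trans_le ht.2)).ne'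
    simp only [w, N, if_pos ht, mul_diagonal, diagonal_mul]
    field_simp
  have hw2 : ∀ t, good t → w t ^ 2 = (ubarR Sbar (Sbar t).1)⁻¹ * (ubarC Sbar (Sbar t).2)⁻¹ := by
    intro t ht
    simp only [w, if_pos ht]
    rw [mul_pow, inv_pow, inv_pow, Real.sq_sqrt (hR0 _), Real.sq_sqrt (hC0 _)]
  have hinv : ∀ y : ℝ, δ / n ≤ y → y⁻¹ ≤ n / δ := by
    intro y hy
    calc y⁻¹ ≤ (δ / n)⁻¹ := inv_anti₀ hθ hy
      _ = _ := by rw [inv_div]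
  have hnδ : (0 : ℝ) ≤ n / δ := by positivity
  have hrow : ∀ i, ∑ t, (if (Sbar t).1 = i then w t ^ 2 else 0) ≤ 2 * s * (n / δ) := by
    refine cnt_row hs (fun t => (Sbar t).1) (ubarR Sbar) (fun a => by rw [ubarR]) (n / δ) hnδ _ ?_
    intro t
    by_cases ht : good t
    · rw [hw2 t ht, mul_comm]
      exact mul_le_mul_of_nonneg_right (hinv _ ht.2) (inv_nonneg.2 (hR0 _))
    · simp only [w, if_neg ht]
      have := mul_nonneg hnδ (inv_nonneg.2 (hR0 (Sbar t).1))
      simpa using this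
  have hcol : ∀ j, ∑ t, (if (Sbar t).2 = j then w t ^ 2 else 0) ≤ 2 * s * (n / δ) := by
    refine cnt_row hs (fun t => (Sbar t).2) (ubarC Sbar) (fun a => by rw [ubarC]) (n / δ) hnδ _ ?_
    intro t
    by_cases ht : good t
    · rw [hw2 t ht]
      exact mul_le_mul_of_nonneg_right (hinv _ ht.1) (inv_nonneg.2 (hC0 _))
    · simp only [w, if_neg ht]
      have := mul_nonneg hnδ (inv_nonneg.2 (hC0 (Sbar t).2))
      simpa using this
  have hbad : ((Finset.univ.filter fun t => ¬ good t).card : ℝ) ≤ 4 * s * δ := by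
    have h1 := cnt_bad hs (fun t => (Sbar t).1) (ubarR Sbar) (fun a => by rw [ubarR]) (δ / n) hθ.le
    have h2 := cnt_bad hs (fun t => (Sbar t).2) (ubarC Sbar) (fun a => by rw [ubarC]) (δ / n) hθ.le
    have h3 : (Finset.univ.filter fun t => ¬ good t) ⊆
        (Finset.univ.filter fun t => ubarR Sbar (Sbar t).1 < δ / n) ∪
        (Finset.univ.filter fun t => ubarC Sbar (Sbar t).2 < δ / n) := by
      intro t ht
      simp only [mem_filter, mem_univ, true_and, mem_union, good, not_and_or, not_le] at ht ⊢
      exact ht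
    have h4 : ((Finset.univ.filter fun t => ¬ good t).card : ℝ) ≤
        ((Finset.univ.filter fun t => ubarR Sbar (Sbar t).1 < δ / n).card : ℝ) +
        ((Finset.univ.filter fun t => ubarC Sbar (Sbar t).2 < δ / n).card : ℝ) := by
      exact_mod_cast (Finset.card_le_card h3).trans (Finset.card_union_le _ _)
    rw [Fintype.card_fin] at h1 h2
    have h5 : (n : ℝ) * (2 * s * (δ / n)) = 2 * s * δ := by field_simp
    have h6 : (m : ℝ) * (2 * s * (δ / n)) ≤ (n : ℝ) * (2 * s * (δ / n)) := by
      refine mul_le_mul_of_nonneg_right (by exact_mod_cast hmn) (by positivity)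
    linarith
  have hsq : Real.sqrt r * Real.sqrt (24 * (2 * s * (n / δ)) * Real.log n) ≤ 7 * (s * δ) := by
    rw [← Real.sqrt_mul (by linarith)]
    refine Real.sqrt_le_iff.2 ⟨by positivity, ?_⟩
    have e1 : r * n * Real.log n = δ ^ 3 * s := by rw [hδ3, hρ]; field_simp
    have e2 : r * (24 * (2 * s * (n / δ)) * Real.log n) = 48 * (s * δ) ^ 2 := by
      calc _ = 48 * s / δ * (r * n * Real.log n) := by ring
        _ = _ := by rw [e1]; field_simp
    rw [e2]
    nlinarith [sq_nonneg (s * δ)]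
  have hpair : ∀ e : Fin s × Bool ≃ Fin (2 * s),
      ∑ σ : Fin s → Bool, F (Bset e σ) ≤ 2 ^ s * (14 * (l + b) * (s * δ)) := by
    intro e
    have := aux_pair hm hmn Sbar good w (2 * s * (n / δ)) (by positivity) hrow hcol N (Real.sqrt r)
      (Real.sqrt_nonneg _) hNtr f l b hl (by
        intro t ht v v'
        rw [hwN t ht, hwN t ht]
        exact hLip _ _ _) (fun t v => hbd _ _) e
    refine this.trans (mul_le_mul_of_nonneg_left ?_ (by positivity))
    have h1 := mul_le_mul_of_nonneg_left hsq hl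
    have h3 : 0 ≤ b * (s * δ) := by positivity
    calc _ ≤ 2 * (l * (7 * (s * δ))) + b * (4 * s * δ) := by
          refine add_le_add (mul_le_mul_of_nonneg_left h1 (by norm_num))
            (mul_le_mul_of_nonneg_left ?_ hb0)
          refine le_trans (le_of_eq ?_) hbad
          congr!
      _ ≤ _ := by linarith
  -- pointwise bound on the excess risk
  have hpt : ∀ B : Finset (Fin (2 * s)), B.card = s →
      empRiskOn ℓ Y Sbar Bᶜ (Xhat B) - sInf ((fun X => empRiskOn ℓ Y Sbar Bᶜ X) '' W) ≤
        η + (F B + F Bᶜ) / s := by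
    intro B hB
    have hBc : (Bᶜ).card = s := by rw [card_compl, hB, Fintype.card_fin]; omega
    have h1 := (hXstar B hB).2
    have h2 := (hX B hB).2 (Xstar B) (hXstar B hB).1
    have h3 : empRiskOn ℓ Y Sbar B (Xstar B) - empRiskOn ℓ Y Sbar Bᶜ (Xstar B) ≤ F B / s := by
      have := le_ciSup (bdd fun v => ∑ t ∈ B, f t v - ∑ t ∈ Bᶜ, f t v) (⟨⟨B, hB⟩, false⟩ : V)
      rw [empRiskOn, empRiskOn, hB, hBc, ← mul_sub, one_div, div_eq_inv_mul]
      exact mul_le_mul_of_nonneg_left this (by positivity)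
    have h4 : empRiskOn ℓ Y Sbar Bᶜ (Xhat B) - empRiskOn ℓ Y Sbar B (Xhat B) ≤ F Bᶜ / s := by
      have := le_ciSup (bdd fun v => ∑ t ∈ Bᶜ, f t v - ∑ t ∈ Bᶜᶜ, f t v) (⟨⟨B, hB⟩, true⟩ : V)
      rw [empRiskOn, empRiskOn, hB, hBc, ← mul_sub, one_div, div_eq_inv_mul]
      refine mul_le_mul_of_nonneg_left (le_trans (le_of_eq ?_) this) (by positivity)
      simp only [compl_compl]
      rfl
    rw [add_div]
    linarith
  refine (Esplit_mono _ _ hpt).trans (Esplit_le _ _ fun e => ?_)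
  have h1 := hpair e
  have h2 := hpair (((Equiv.refl (Fin s)).prodCongr Equiv.boolNot).trans e)
  simp only [← Bset_swap, ← Bset_compl] at h2
  rw [Finset.sum_add_distrib, ← Finset.sum_div, Finset.sum_add_distrib, Finset.sum_const,
    nsmul_eq_mul, Finset.card_univ]
  have h3 : ((Fintype.card (Fin s → Bool) : ℕ) : ℝ) * η = 2 ^ s * η := by simp
  rw [h3]
  have h4 : (∑ σ : Fin s → Bool, F (Bset e σ) + ∑ σ : Fin s → Bool, F (Bset e σ)ᶜ) / s ≤
      2 ^ s * (28 * (l + b) * δ) := by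
    rw [div_le_iff₀ hsR]
    calc _ ≤ _ := add_le_add h1 h2
      _ = _ := by ring
  linarith

end
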